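/- Suppose P is a unit Killing vector field: g(P,P) = 1 and g(∇_X P, Y) + g(∇_Y P, X) = 0 for all vector fields X, Y. Then ∇S ≡ 0 (i.e. (∇_X S)(Y,Z) = 0 for all vector fields X, Y, Z) if and only if for all vector fields X, Y, Z: (∇̄_X Ŝ)(Y,Z) = g(X,Z)·S̄(Y,P) − g(Y,P)·S̄(X,Z) + g(X,Y)·S̄(Z,P) − g(Z,P)·S̄(X,Y). -/

import Mathlib

open scoped BigOperators

/-! Setup: an open set `U ⊆ ℝⁿ` with a Riemannian metric given by component functions
`g x i j`, the Levi-Civita connection computed from the Christoffel symbols, the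
semi-symmetric metric connection `∇̄_X Y = ∇_X Y + π(Y)X − g(X,Y)P`, curvature and
Ricci tensors of a connection, and covariant derivatives of `(0,2)`-tensors. -/

/-- A vector field on (an open subset of) `ℝⁿ`. -/
abbrev VF (n : ℕ) := (Fin n → ℝ) → Fin n → ℝ

/-- Partial derivative `∂ᵢ f` of a real-valued function. -/
noncomputable def pd {n : ℕ} (i : Fin n) (f : (Fin n → ℝ) → ℝ) (x : Fin n → ℝ) : ℝ :=
  fderiv ℝ f x (Pi.single i 1)

/-- The metric evaluated on two tangent vectors at the point `x`. -/
def gval {n : ℕ} (g : (Fin n → ℝ) → Fin n → Fin n → ℝ) (x v w : Fin n → ℝ) : ℝ :=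
  ∑ i, ∑ j, g x i j * v i * w j

/-- The Christoffel symbols `Γ^k_{ij} = ½ g^{kl}(∂ᵢ g_{jl} + ∂ⱼ g_{il} − ∂_l g_{ij})`. -/
noncomputable def christoffel {n : ℕ} (g : (Fin n → ℝ) → Fin n → Fin n → ℝ)
    (x : Fin n → ℝ) (k i j : Fin n) : ℝ :=
  (1 / 2) * ∑ l, (Matrix.of (g x))⁻¹ k l *
    (pd i (fun y => g y j l) x + pd j (fun y => g y i l) x - pd l (fun y => g y i j) x)

/-- The Levi-Civita covariant derivative `(∇_X Y)^k = X^i ∂ᵢ Y^k + Γ^k_{ij} X^i Y^j`. -/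
noncomputable def lcCov {n : ℕ} (g : (Fin n → ℝ) → Fin n → Fin n → ℝ)
    (X Y : VF n) (x : Fin n → ℝ) : Fin n → ℝ :=
  fun k => fderiv ℝ (fun y => Y y k) x (X x) +
    ∑ i, ∑ j, christoffel g x k i j * X x i * Y x j

/-- The semi-symmetric metric connection `∇̄_X Y = ∇_X Y + π(Y)X − g(X,Y)P`,
where `π(X) = g(X,P)`. -/
noncomputable def ssCov {n : ℕ} (g : (Fin n → ℝ) → Fin n → Fin n → ℝ)
    (P : VF n) (X Y : VF n) (x : Fin n → ℝ) : Fin n → ℝ :=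
  fun k => lcCov g X Y x k + gval g x (Y x) (P x) * X x k - gval g x (X x) (Y x) * P x k

/-- The Lie bracket of vector fields. -/
noncomputable def lie {n : ℕ} (X Y : VF n) (x : Fin n → ℝ) : Fin n → ℝ :=
  fun k => fderiv ℝ (fun y => Y y k) x (X x) - fderiv ℝ (fun y => X y k) x (Y x)

/-- The curvature `R_D(X,Y)Z = D_X D_Y Z − D_Y D_X Z − D_{[X,Y]}Z` of a connection `D`. -/
noncomputable def curv {n : ℕ} (D : VF n → VF n → VF n) (X Y Z : VF n)
    (x : Fin n → ℝ) : Fin n → ℝ :=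
  fun k => D X (D Y Z) x k - D Y (D X Z) x k - D (lie X Y) Z x k

/-- The Ricci tensor `Ric_D(Y,Z) = trace (X ↦ R_D(X,Y)Z)` of a connection `D`
(the trace computed in the coordinate frame). -/
noncomputable def ricci {n : ℕ} (D : VF n → VF n → VF n) (Y Z : VF n)
    (x : Fin n → ℝ) : ℝ :=
  ∑ i, curv D (fun _ => Pi.single i 1) Y Z x i

/-- The symmetrization `Ŝ(Y,Z) = ½(S̄(Y,Z) + S̄(Z,Y))` of the Ricci tensor of the
semi-symmetric metric connection. -/
noncomputable def shat {n : ℕ} (g : (Fin n → ℝ) → Fin n → Fin n → ℝ)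
    (P : VF n) (Y Z : VF n) (x : Fin n → ℝ) : ℝ :=
  (ricci (ssCov g P) Y Z x + ricci (ssCov g P) Z Y x) / 2

/-- The covariant derivative `(D_X T)(Y,Z) = X(T(Y,Z)) − T(D_X Y, Z) − T(Y, D_X Z)` of a
`(0,2)`-tensor `T` along the connection `D`. -/
noncomputable def covT {n : ℕ} (D : VF n → VF n → VF n)
    (T : VF n → VF n → (Fin n → ℝ) → ℝ) (X Y Z : VF n) (x : Fin n → ℝ) : ℝ :=
  fderiv ℝ (T Y Z) x (X x) - T (D X Y) Z x - T Y (D X Z) x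

/-- Smoothness of a vector-field/metric-type map on `U`. -/
def SmoothVF {n : ℕ} {E : Type*} [NormedAddCommGroup E] [NormedSpace ℝ E]
    (U : Set (Fin n → ℝ)) (f : (Fin n → ℝ) → E) : Prop :=
  ContDiffOn ℝ (⊤ : ℕ∞) f U

open scoped ContDiff

section helpers
variable {n : ℕ}

/-- smooth scalar function -/
def Sm (U : Set (Fin n → ℝ)) (f : (Fin n → ℝ) → ℝ) : Prop := ContDiffOn ℝ ∞ f U

theorem Sm.add {U : Set (Fin n → ℝ)} {f g : (Fin n → ℝ) → ℝ} (hf : Sm U f) (hg : Sm U g) :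
    Sm U (fun x => f x + g x) := ContDiffOn.add hf hg
theorem Sm.sub {U : Set (Fin n → ℝ)} {f g : (Fin n → ℝ) → ℝ} (hf : Sm U f) (hg : Sm U g) :
    Sm U (fun x => f x - g x) := ContDiffOn.sub hf hg
theorem Sm.mul {U : Set (Fin n → ℝ)} {f g : (Fin n → ℝ) → ℝ} (hf : Sm U f) (hg : Sm U g) :
    Sm U (fun x => f x * g x) := ContDiffOn.mul hf hg
theorem Sm.const {U : Set (Fin n → ℝ)} (c : ℝ) : Sm U (fun _ => c) := contDiffOn_const
theorem Sm.sum {U : Set (Fin n → ℝ)} {ι : Type*} {s : Finset ι} {f : ι → (Fin n → ℝ) → ℝ}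
    (h : ∀ i, Sm U (f i)) :
    Sm U (fun x => ∑ i ∈ s, f i x) := ContDiffOn.sum (fun i _ => h i)
theorem Sm.prod {U : Set (Fin n → ℝ)} {ι : Type*} {s : Finset ι} {f : ι → (Fin n → ℝ) → ℝ}
    (h : ∀ i, Sm U (f i)) :
    Sm U (fun x => ∏ i ∈ s, f i x) := contDiffOn_prod (fun i _ => h i)
theorem Sm.congr {U : Set (Fin n → ℝ)} {f g : (Fin n → ℝ) → ℝ} (hf : Sm U f)
    (h : ∀ x ∈ U, g x = f x) : Sm U g := ContDiffOn.congr hf h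
theorem Sm.diff {U : Set (Fin n → ℝ)} (hU : IsOpen U) {f : (Fin n → ℝ) → ℝ} (hf : Sm U f)
    {x : Fin n → ℝ} (hx : x ∈ U) : DifferentiableAt ℝ f x :=
  (ContDiffOn.contDiffAt hf (hU.mem_nhds hx)).differentiableAt (by simp)
theorem Sm.pd {U : Set (Fin n → ℝ)} (hU : IsOpen U) {f : (Fin n → ℝ) → ℝ} (hf : Sm U f)
    (i : Fin n) : Sm U (pd i f) := by
  have h := ContDiffOn.fderiv_of_isOpen (m := ∞) hf hU (by simp)
  exact h.clm_apply contDiffOn_const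

theorem fderiv_eq_sum (f : (Fin n → ℝ) → ℝ) (x v : Fin n → ℝ) :
    fderiv ℝ f x v = ∑ i, v i * pd i f x := by
  conv_lhs => rw [pi_eq_sum_univ' v]
  simp [pd, map_sum]

theorem pd_congr {U : Set (Fin n → ℝ)} (hU : IsOpen U) {f g : (Fin n → ℝ) → ℝ}
    (h : ∀ x ∈ U, f x = g x) {x : Fin n → ℝ} (hx : x ∈ U) (i : Fin n) : pd i f x = pd i g x := by
  unfold pd
  rw [Filter.EventuallyEq.fderiv_eq (Filter.eventuallyEq_of_mem (hU.mem_nhds hx) h)]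

theorem pd_add {f g : (Fin n → ℝ) → ℝ} {x : Fin n → ℝ} (hf : DifferentiableAt ℝ f x)
    (hg : DifferentiableAt ℝ g x) (i : Fin n) :
    pd i (fun y => f y + g y) x = pd i f x + pd i g x := by
  unfold pd; rw [fderiv_fun_add hf hg]; rfl
theorem pd_sub {f g : (Fin n → ℝ) → ℝ} {x : Fin n → ℝ} (hf : DifferentiableAt ℝ f x)
    (hg : DifferentiableAt ℝ g x) (i : Fin n) :
    pd i (fun y => f y - g y) x = pd i f x - pd i g x := by
  unfold pd; rw [fderiv_fun_sub hf hg]; rfl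
theorem pd_mul {f g : (Fin n → ℝ) → ℝ} {x : Fin n → ℝ} (hf : DifferentiableAt ℝ f x)
    (hg : DifferentiableAt ℝ g x) (i : Fin n) :
    pd i (fun y => f y * g y) x = pd i f x * g x + f x * pd i g x := by
  unfold pd; rw [fderiv_fun_mul hf hg]; simp; ring
theorem pd_const (c : ℝ) (x : Fin n → ℝ) (i : Fin n) : pd i (fun _ => c) x = 0 := by
  simp [pd]
theorem pd_sum {ι : Type*} {s : Finset ι} {f : ι → (Fin n → ℝ) → ℝ} {x : Fin n → ℝ}
    (hf : ∀ a, DifferentiableAt ℝ (f a) x) (i : Fin n) :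
    pd i (fun y => ∑ a ∈ s, f a y) x = ∑ a ∈ s, pd i (f a) x := by
  unfold pd; rw [fderiv_fun_sum (fun a _ => hf a)]; simp

theorem pd_comm {U : Set (Fin n → ℝ)} (hU : IsOpen U) {f : (Fin n → ℝ) → ℝ} (hf : Sm U f)
    {x : Fin n → ℝ} (hx : x ∈ U) (i j : Fin n) : pd i (pd j f) x = pd j (pd i f) x := by
  have hc : ContDiffAt ℝ ∞ f x := ContDiffOn.contDiffAt hf (hU.mem_nhds hx)
  have hs : IsSymmSndFDerivAt ℝ f x := hc.isSymmSndFDerivAt (by simp; exact WithTop.coe_le_coe.2 (le_top : (2 : ℕ∞) ≤ ⊤))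
  have hd : DifferentiableAt ℝ (fderiv ℝ f) x :=
    (hc.fderiv_right (m := ∞) (by simp)).differentiableAt (by simp)
  have key : ∀ a b : Fin n, pd a (pd b f) x =
      fderiv ℝ (fderiv ℝ f) x (Pi.single a 1) (Pi.single b 1) := by
    intro a b
    unfold pd
    rw [fderiv_clm_apply hd (by fun_prop)]
    simp
  rw [key, key]
  exact hs _ _

/-- connection with coefficients `C` -/
noncomputable def conn (C : (Fin n → ℝ) → Fin n → Fin n → Fin n → ℝ) (X Y : VF n) : VF n :=
  fun x k => fderiv ℝ (fun y => Y y k) x (X x) + ∑ i, ∑ j, C x k i j * X x i * Y x j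

noncomputable def ricC (C : (Fin n → ℝ) → Fin n → Fin n → Fin n → ℝ) (x : Fin n → ℝ)
    (j k : Fin n) : ℝ :=
  ∑ i, (pd i (fun y => C y i j k) x - pd j (fun y => C y i i k) x +
    ∑ m, (C x i i m * C x m j k - C x i j m * C x m i k))

theorem smVF_iff {U : Set (Fin n → ℝ)} {X : VF n} : SmoothVF U X ↔ ∀ k, Sm U (fun x => X x k) :=
  contDiffOn_pi

theorem conn_smooth {U : Set (Fin n → ℝ)} (hU : IsOpen U)
    {C : (Fin n → ℝ) → Fin n → Fin n → Fin n → ℝ} (hC : ∀ i j k, Sm U (fun x => C x i j k))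
    {X Y : VF n} (hX : SmoothVF U X) (hY : SmoothVF U Y) : SmoothVF U (conn C X Y) := by
  rw [smVF_iff] at *
  intro k
  unfold conn
  simp only [fderiv_eq_sum]
  exact (Sm.sum fun i => (hX i).mul ((hY k).pd hU i)).add
    (Sm.sum fun i => Sm.sum fun j => ((hC k i j).mul (hX i)).mul (hY j))

theorem ricC_smooth {U : Set (Fin n → ℝ)} (hU : IsOpen U)
    {C : (Fin n → ℝ) → Fin n → Fin n → Fin n → ℝ} (hC : ∀ i j k, Sm U (fun x => C x i j k))
    (j k : Fin n) : Sm U (fun x => ricC C x j k) := by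
  unfold ricC
  exact Sm.sum fun i => (((hC i j k).pd hU i).sub ((hC i i k).pd hU j)).add
    (Sm.sum fun m => ((hC i i m).mul (hC m j k)).sub ((hC i j m).mul (hC m i k)))

theorem ricci_conn {U : Set (Fin n → ℝ)} (hU : IsOpen U)
    {C : (Fin n → ℝ) → Fin n → Fin n → Fin n → ℝ} (hC : ∀ i j k, Sm U (fun x => C x i j k))
    {Y Z : VF n} (hY : SmoothVF U Y) (hZ : SmoothVF U Z) {x : Fin n → ℝ} (hx : x ∈ U) :
    ricci (conn C) Y Z x = ∑ j, ∑ k, ricC C x j k * Y x j * Z x k := by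
  rw [smVF_iff] at hY hZ
  have dC := fun i j k => (hC i j k).diff hU hx
  have dY := fun i => (hY i).diff hU hx
  have dZ := fun i => (hZ i).diff hU hx
  have dZ' := fun i j => ((hZ i).pd hU j).diff hU hx
  have e1 : ∀ i, curv (conn C) (fun _ => Pi.single i 1) Y Z x i =
      ∑ j, ∑ k, (pd i (fun y => C y i j k) x - pd j (fun y => C y i i k) x +
    ∑ m, (C x i i m * C x m j k - C x i j m * C x m i k)) * Y x j * Z x k := by
    intro i
    unfold curv
    have h1 : conn C (fun _ => Pi.single i 1) (conn C Y Z) x i =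
        (∑ a, (pd i (fun y => Y y a) x * pd a (fun y => Z y i) x +
            Y x a * pd i (pd a (fun y => Z y i)) x)) +
        (∑ a, ∑ b, (pd i (fun y => C y i a b) x * Y x a * Z x b
          + C x i a b * pd i (fun y => Y y a) x * Z x b
          + C x i a b * Y x a * pd i (fun y => Z y b) x)) +
        ∑ b, C x i i b * (∑ a, Y x a * pd a (fun y => Z y b) x +
          ∑ a, ∑ c, C x b a c * Y x a * Z x c) := by
      have : conn C (fun _ => Pi.single i 1) (conn C Y Z) x i =
        pd i (fun y => ∑ a, Y y a * pd a (fun y => Z y i) y + ∑ a, ∑ b, C y i a b * Y y a * Z y b) x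
        + ∑ b, C x i i b * (∑ a, Y x a * pd a (fun y => Z y b) x +
          ∑ a, ∑ c, C x b a c * Y x a * Z x c) := by
        simp [conn, fderiv_eq_sum, Pi.single_apply]
      rw [this, pd_add (by fun_prop) (by fun_prop), pd_sum (by fun_prop), pd_sum (by fun_prop)]
      congr 2
      · refine Finset.sum_congr rfl fun a _ => ?_
        rw [pd_mul (by fun_prop) (by fun_prop)]
      · refine Finset.sum_congr rfl fun a _ => ?_
        rw [pd_sum (by fun_prop)]
        refine Finset.sum_congr rfl fun b _ => ?_
        rw [pd_mul (by fun_prop) (by fun_prop), pd_mul (by fun_prop) (by fun_prop)]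
        ring
    have h2 : conn C Y (conn C (fun _ => Pi.single i 1) Z) x i =
        (∑ a, Y x a * (pd a (pd i (fun y => Z y i)) x +
          ∑ b, (pd a (fun y => C y i i b) x * Z x b + C x i i b * pd a (fun y => Z y b) x)))
        + ∑ a, ∑ b, C x i a b * Y x a * (pd i (fun y => Z y b) x + ∑ c, C x b i c * Z x c) := by
      have : conn C Y (conn C (fun _ => Pi.single i 1) Z) x i =
        (∑ a, Y x a * pd a (fun y => pd i (fun y => Z y i) y + ∑ b, C y i i b * Z y b) x)
        + ∑ a, ∑ b, C x i a b * Y x a * (pd i (fun y => Z y b) x + ∑ c, C x b i c * Z x c) := by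
        simp [conn, fderiv_eq_sum, Pi.single_apply]
      rw [this]
      congr 1
      refine Finset.sum_congr rfl fun a _ => ?_
      rw [pd_add (by fun_prop) (by fun_prop), pd_sum (by fun_prop)]
      congr 2
      refine Finset.sum_congr rfl fun b _ => ?_
      rw [pd_mul (by fun_prop) (by fun_prop)]
    have h3 : conn C (lie (fun _ => Pi.single i 1) Y) Z x i =
        ∑ a, pd i (fun y => Y y a) x * pd a (fun y => Z y i) x +
        ∑ a, ∑ b, C x i a b * pd i (fun y => Y y a) x * Z x b := by
      simp [conn, lie, fderiv_eq_sum, Pi.single_apply]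
    rw [h1, h2, h3]
    have h4 : ∑ b, C x i i b * (∑ a, Y x a * pd a (fun y => Z y b) x +
          ∑ a, ∑ c, C x b a c * Y x a * Z x c) =
        ∑ a, ∑ b, (C x i i b * Y x a * pd a (fun y => Z y b) x
           + (∑ m, C x i i m * C x m a b) * Y x a * Z x b) := by
      simp only [mul_add, Finset.sum_add_distrib, Finset.mul_sum, Finset.sum_mul]
      congr 1
      · rw [Finset.sum_comm]; simp only [mul_assoc]
      · rw [Finset.sum_comm]
        refine Finset.sum_congr rfl fun a _ => ?_
        rw [Finset.sum_comm]; simp only [mul_assoc]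
    have h5 : ∑ a, ∑ b, C x i a b * Y x a * (pd i (fun y => Z y b) x + ∑ c, C x b i c * Z x c) =
        ∑ a, ∑ b, (C x i a b * Y x a * pd i (fun y => Z y b) x
           + (∑ m, C x i a m * C x m i b) * Y x a * Z x b) := by
      simp only [mul_add, Finset.sum_add_distrib, Finset.mul_sum, Finset.sum_mul]
      congr 1
      refine Finset.sum_congr rfl fun a _ => ?_
      rw [Finset.sum_comm]
      refine Finset.sum_congr rfl fun b _ => Finset.sum_congr rfl fun c _ => ?_
      ring
    rw [h4, h5]
    simp only [← Finset.sum_add_distrib, ← Finset.sum_sub_distrib]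
    refine Finset.sum_congr rfl fun a _ => ?_
    rw [pd_comm hU (hZ i) hx i a]
    have h6 : ∀ c d e f g h k : ℝ, g = e + f - h - k  → c + d + e + f - (d + h + k) - c = g := by
      intros; linarith
    simp only [mul_add]
    rw [← sub_eq_zero]
    simp only [Finset.mul_sum, Finset.sum_sub_distrib, Finset.sum_add_distrib, add_mul, sub_mul, mul_add]
    have h7 : ∀ (q : Fin n → ℝ) , ∑ b, Y x a * (C x i i b * q b) = ∑ b, C x i i b * Y x a * q b :=
      fun q => Finset.sum_congr rfl fun b _ => by ring
    have h8 : ∀ (q : Fin n → ℝ) , ∑ b, Y x a * (q b * Z x b) = ∑ b, q b * Y x a * Z x b :=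
      fun q => Finset.sum_congr rfl fun b _ => by ring
    rw [h7, h8 (fun b => pd a (fun y => C y i i b) x)]
    ring
  unfold ricci
  simp only [e1]
  unfold ricC
  rw [Finset.sum_comm]
  refine Finset.sum_congr rfl fun a _ => ?_
  rw [Finset.sum_comm]
  refine Finset.sum_congr rfl fun b _ => ?_
  simp only [Finset.sum_mul]

/-- covariant derivative components -/
noncomputable def covC (C : (Fin n → ℝ) → Fin n → Fin n → Fin n → ℝ)
    (t : (Fin n → ℝ) → Fin n → Fin n → ℝ) (x : Fin n → ℝ) (i j k : Fin n) : ℝ :=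
  pd i (fun y => t y j k) x - (∑ m, C x m i j * t x m k) - ∑ m, C x m i k * t x j m

theorem covT_conn {U : Set (Fin n → ℝ)} (hU : IsOpen U)
    {C : (Fin n → ℝ) → Fin n → Fin n → Fin n → ℝ} (hC : ∀ i j k, Sm U (fun x => C x i j k))
    {T : VF n → VF n → (Fin n → ℝ) → ℝ} {t : (Fin n → ℝ) → Fin n → Fin n → ℝ}
    (ht : ∀ i j, Sm U (fun x => t x i j))
    (hT : ∀ Y Z, SmoothVF U Y → SmoothVF U Z → ∀ x ∈ U,
      T Y Z x = ∑ j, ∑ k, t x j k * Y x j * Z x k)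
    {X Y Z : VF n} (hX : SmoothVF U X)
    (hY : SmoothVF U Y) (hZ : SmoothVF U Z) {x : Fin n → ℝ} (hx : x ∈ U) :
    covT (conn C) T X Y Z x = ∑ i, ∑ j, ∑ k, covC C t x i j k * X x i * Y x j * Z x k := by
  have dt := fun i j => (ht i j).diff hU hx
  have dY := fun i => (smVF_iff.1 hY i).diff hU hx
  have dZ := fun i => (smVF_iff.1 hZ i).diff hU hx
  unfold covT
  rw [hT _ _ (conn_smooth hU hC hX hY) hZ x hx, hT _ _ hY (conn_smooth hU hC hX hZ) x hx]
  have h1 : fderiv ℝ (T Y Z) x (X x) = ∑ i, ∑ j, ∑ k, (pd i (fun y => t y j k) x * X x i * Y x j * Z x k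
      + t x j k * X x i * pd i (fun y => Y y j) x * Z x k
      + t x j k * X x i * Y x j * pd i (fun y => Z y k) x) := by
    rw [fderiv_eq_sum]
    refine Finset.sum_congr rfl fun i _ => ?_
    rw [pd_congr hU (fun y hy => hT Y Z hY hZ y hy) hx, pd_sum (by fun_prop), Finset.mul_sum]
    refine Finset.sum_congr rfl fun j _ => ?_
    rw [pd_sum (by fun_prop), Finset.mul_sum]
    refine Finset.sum_congr rfl fun k _ => ?_
    rw [pd_mul (by fun_prop) (by fun_prop), pd_mul (by fun_prop) (by fun_prop)]
    ring
  have h2 : ∑ j, ∑ k, t x j k * conn C X Y x j * Z x k =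
      ∑ i, ∑ j, ∑ k, (t x j k * X x i * pd i (fun y => Y y j) x * Z x k
        + (∑ m, C x m i j * t x m k) * X x i * Y x j * Z x k) := by
    simp only [Finset.sum_add_distrib, conn, fderiv_eq_sum, mul_add, add_mul]
    congr 1
    · simp only [Finset.mul_sum, Finset.sum_mul]
      rw [Finset.sum_comm_cycle]
      refine Finset.sum_congr rfl fun i _ => ?_
      refine Finset.sum_congr rfl fun j _ => Finset.sum_congr rfl fun k _ => ?_
      ring
    · simp only [Finset.mul_sum, Finset.sum_mul]
      rw [Finset.sum_comm_cycle]
      refine Finset.sum_congr rfl fun i _ => ?_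
      rw [Finset.sum_comm_cycle]
      refine Finset.sum_congr rfl fun j _ => ?_
      rw [Finset.sum_comm]
      refine Finset.sum_congr rfl fun k _ => Finset.sum_congr rfl fun m _ => ?_
      ring
  have h3 : ∑ j, ∑ k, t x j k * Y x j * conn C X Z x k =
      ∑ i, ∑ j, ∑ k, (t x j k * X x i * Y x j * pd i (fun y => Z y k) x
        + (∑ m, C x m i k * t x j m) * X x i * Y x j * Z x k) := by
    simp only [Finset.sum_add_distrib, conn, fderiv_eq_sum, mul_add]
    congr 1
    · simp only [Finset.mul_sum]
      rw [Finset.sum_comm_cycle]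
      refine Finset.sum_congr rfl fun i _ => ?_
      refine Finset.sum_congr rfl fun j _ => Finset.sum_congr rfl fun k _ => ?_
      ring
    · simp only [Finset.mul_sum, Finset.sum_mul]
      rw [Finset.sum_comm_cycle]
      refine Finset.sum_congr rfl fun i _ => Finset.sum_congr rfl fun j _ => ?_
      rw [Finset.sum_comm]
      refine Finset.sum_congr rfl fun k _ => Finset.sum_congr rfl fun m _ => ?_
      ring
  rw [h1, h2, h3]
  simp only [← Finset.sum_sub_distrib]
  refine Finset.sum_congr rfl fun i _ => Finset.sum_congr rfl fun j _ => Finset.sum_congr rfl fun k _ => ?_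
  unfold covC
  ring

end helpers

section metric
variable {n : ℕ} {U : Set (Fin n → ℝ)} {g : (Fin n → ℝ) → Fin n → Fin n → ℝ} {P : VF n}

/-- inverse metric -/
noncomputable def gi (g : (Fin n → ℝ) → Fin n → Fin n → ℝ) (x : Fin n → ℝ) (i j : Fin n) : ℝ :=
  (Matrix.of (g x))⁻¹ i j

/-- the one-form of `P` -/
noncomputable def pf (g : (Fin n → ℝ) → Fin n → Fin n → ℝ) (P : VF n) (x : Fin n → ℝ)
    (j : Fin n) : ℝ := ∑ m, g x j m * P x m

noncomputable def cbar (g : (Fin n → ℝ) → Fin n → Fin n → ℝ) (P : VF n) (x : Fin n → ℝ)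
    (k i j : Fin n) : ℝ :=
  christoffel g x k i j + (if k = i then 1 else 0) * pf g P x j - g x i j * P x k

theorem lcCov_eq : lcCov g = conn (christoffel g) := rfl

theorem ssCov_eq : ssCov g P = conn (cbar g P) := by
  funext X Y x k
  unfold ssCov conn cbar lcCov gval pf
  simp only [add_mul, sub_mul, Finset.sum_add_distrib, Finset.sum_sub_distrib]
  have h1 : ∑ i, ∑ j, (if k = i then (1:ℝ) else 0) * (∑ m, g x j m * P x m) * X x i * Y x j =
      (∑ i, ∑ j, g x i j * Y x i * P x j) * X x k := by
    simp only [ite_mul, one_mul, zero_mul, Finset.sum_mul]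
    rw [Finset.sum_comm]
    simp only [Finset.sum_ite_eq, Finset.mem_univ, if_true]
    refine Finset.sum_congr rfl fun i _ => Finset.sum_congr rfl fun j _ => ?_
    ring
  have h2 : ∑ i, ∑ j, g x i j * P x k * X x i * Y x j =
      (∑ i, ∑ j, g x i j * X x i * Y x j) * P x k := by
    simp only [Finset.sum_mul]
    refine Finset.sum_congr rfl fun i _ => Finset.sum_congr rfl fun j _ => ?_
    ring
  rw [h1, h2]; ring

theorem g_sm (hg : SmoothVF U g) (i j : Fin n) : Sm U (fun x => g x i j) :=
  contDiffOn_pi.1 (contDiffOn_pi.1 hg i) j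

theorem det_sm {M : (Fin n → ℝ) → Matrix (Fin n) (Fin n) ℝ} (h : ∀ i j, Sm U (fun x => M x i j)) :
    Sm U (fun x => (M x).det) := by
  simp only [Matrix.det_apply']
  exact Sm.sum fun σ => (Sm.const _).mul (Sm.prod fun i => h _ _)

theorem gi_sm (hg : SmoothVF U g) (hgpos : ∀ x ∈ U, (Matrix.of (g x)).PosDef) (i j : Fin n) :
    Sm U (fun x => gi g x i j) := by
  have h1 : Sm U (fun x => (Matrix.of (g x)).det) := det_sm (fun i j => g_sm hg i j)
  have h2 : Sm U (fun x => (Matrix.of (g x)).det⁻¹) :=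
    ContDiffOn.inv h1 (fun x hx => (hgpos x hx).det_pos.ne')
  have h3 : Sm U (fun x => (Matrix.of (g x)).adjugate i j) := by
    simp only [Matrix.adjugate_apply]
    refine det_sm fun a b => ?_
    by_cases hab : a = j
    · subst hab; simp only [Matrix.updateRow_self]; exact Sm.const _
    · simp only [Matrix.updateRow_ne hab]; exact g_sm hg a b
  refine (h2.mul h3).congr fun x hx => ?_
  simp [gi, Matrix.inv_def]

theorem chr_sm (hU : IsOpen U) (hg : SmoothVF U g) (hgpos : ∀ x ∈ U, (Matrix.of (g x)).PosDef)
    (k i j : Fin n) : Sm U (fun x => christoffel g x k i j) := by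
  unfold christoffel
  exact (Sm.const _).mul (Sm.sum fun l => (gi_sm hg hgpos k l).mul
    ((((g_sm hg j l).pd hU i).add ((g_sm hg i l).pd hU j)).sub ((g_sm hg i j).pd hU l)))

theorem pf_sm (hg : SmoothVF U g) (hP : SmoothVF U P) (j : Fin n) : Sm U (fun x => pf g P x j) :=
  Sm.sum fun m => (g_sm hg j m).mul (smVF_iff.1 hP m)

theorem cbar_sm (hU : IsOpen U) (hg : SmoothVF U g) (hgpos : ∀ x ∈ U, (Matrix.of (g x)).PosDef)
    (hP : SmoothVF U P) (k i j : Fin n) : Sm U (fun x => cbar g P x k i j) :=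
  ((chr_sm hU hg hgpos k i j).add ((Sm.const _).mul (pf_sm hg hP j))).sub
    ((g_sm hg i j).mul (smVF_iff.1 hP k))

theorem g_symm (hgpos : ∀ x ∈ U, (Matrix.of (g x)).PosDef) {x : Fin n → ℝ} (hx : x ∈ U)
    (i j : Fin n) : g x i j = g x j i := by
  have := (hgpos x hx).1.apply i j
  simpa using this.symm

theorem gi_symm (hgpos : ∀ x ∈ U, (Matrix.of (g x)).PosDef) {x : Fin n → ℝ} (hx : x ∈ U)
    (i j : Fin n) : gi g x i j = gi g x j i := by
  have := (hgpos x hx).inv.1.apply i j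
  simpa [gi] using this.symm

theorem g_gi (hgpos : ∀ x ∈ U, (Matrix.of (g x)).PosDef) {x : Fin n → ℝ} (hx : x ∈ U)
    (i j : Fin n) : ∑ m, g x i m * gi g x m j = if i = j then 1 else 0 := by
  have h := Matrix.mul_nonsing_inv (Matrix.of (g x)) ((hgpos x hx).det_pos.ne'.isUnit)
  have := congrFun (congrFun h i) j
  simpa [gi, Matrix.mul_apply, Matrix.one_apply] using this

theorem gi_g (hgpos : ∀ x ∈ U, (Matrix.of (g x)).PosDef) {x : Fin n → ℝ} (hx : x ∈ U)
    (i j : Fin n) : ∑ m, gi g x i m * g x m j = if i = j then 1 else 0 := by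
  have h := Matrix.nonsing_inv_mul (Matrix.of (g x)) ((hgpos x hx).det_pos.ne'.isUnit)
  have := congrFun (congrFun h i) j
  simpa [gi, Matrix.mul_apply, Matrix.one_apply] using this

theorem dg_symm (hU : IsOpen U) (hgpos : ∀ x ∈ U, (Matrix.of (g x)).PosDef) {x : Fin n → ℝ}
    (hx : x ∈ U) (a i j : Fin n) : pd a (fun y => g y i j) x = pd a (fun y => g y j i) x :=
  pd_congr hU (fun _ hy => g_symm hgpos hy i j) hx a

theorem chr_symm (hU : IsOpen U) (hgpos : ∀ x ∈ U, (Matrix.of (g x)).PosDef) {x : Fin n → ℝ}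
    (hx : x ∈ U) (k i j : Fin n) : christoffel g x k i j = christoffel g x k j i := by
  unfold christoffel
  congr 1
  refine Finset.sum_congr rfl fun l _ => ?_
  rw [dg_symm hU hgpos hx l i j]; ring

theorem chr_lower (hgpos : ∀ x ∈ U, (Matrix.of (g x)).PosDef) {x : Fin n → ℝ}
    (hx : x ∈ U) (a i j : Fin n) : ∑ m, g x a m * christoffel g x m i j =
      (1 / 2) * (pd i (fun y => g y j a) x + pd j (fun y => g y i a) x
        - pd a (fun y => g y i j) x) := by
  have h : ∀ m, christoffel g x m i j = (1 / 2) * ∑ l, gi g x m l * (pd i (fun y => g y j l) x +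
    pd j (fun y => g y i l) x - pd l (fun y => g y i j) x) := fun m => rfl
  simp only [h]
  generalize hq : (fun l => pd i (fun y => g y j l) x +
    pd j (fun y => g y i l) x - pd l (fun y => g y i j) x) = q
  have hq' := fun l => congrFun hq l
  simp only [fun l => (hq' l : _ = q l)]
  have : ∑ m, g x a m * (1 / 2 * ∑ l, gi g x m l * q l) =
      (1 / 2) * ∑ l, (∑ m, g x a m * gi g x m l) * q l := by
    simp only [Finset.mul_sum, Finset.sum_mul]
    rw [Finset.sum_comm]
    refine Finset.sum_congr rfl fun i _ => Finset.sum_congr rfl fun j _ => ?_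
    ring
  rw [this]
  simp [g_gi hgpos hx]

theorem compat (hU : IsOpen U) (hgpos : ∀ x ∈ U, (Matrix.of (g x)).PosDef) {x : Fin n → ℝ}
    (hx : x ∈ U) (i j k : Fin n) : pd i (fun y => g y j k) x =
      ∑ m, g x k m * christoffel g x m i j + ∑ m, g x j m * christoffel g x m i k := by
  rw [chr_lower hgpos hx, chr_lower hgpos hx, dg_symm hU hgpos hx i k j]
  ring

theorem tau_eq (hU : IsOpen U) (hgpos : ∀ x ∈ U, (Matrix.of (g x)).PosDef) {x : Fin n → ℝ}
    (hx : x ∈ U) (k : Fin n) : ∑ i, christoffel g x i i k =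
      ∑ i, ∑ l, (1 / 2) * (gi g x i l * pd k (fun y => g y i l) x) := by
  have h : ∀ m, christoffel g x m m k = (1 / 2) * ∑ l, gi g x m l * (pd m (fun y => g y k l) x +
    pd k (fun y => g y m l) x - pd l (fun y => g y m k) x) := fun m => rfl
  simp only [h, mul_sub, mul_add, Finset.mul_sum, Finset.sum_add_distrib, Finset.sum_sub_distrib]
  have h2 : ∑ i, ∑ l, 1 / 2 * (gi g x i l * pd i (fun y => g y k l) x) =
      ∑ i, ∑ l, 1 / 2 * (gi g x i l * pd l (fun y => g y i k) x) := by
    rw [Finset.sum_comm]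
    refine Finset.sum_congr rfl fun i _ => Finset.sum_congr rfl fun j _ => ?_
    rw [gi_symm hgpos hx, dg_symm hU hgpos hx]
  rw [h2]; ring

theorem dgi_dg (hU : IsOpen U) (hg : SmoothVF U g) (hgpos : ∀ x ∈ U, (Matrix.of (g x)).PosDef)
    {x : Fin n → ℝ} (hx : x ∈ U) (j k : Fin n) :
    ∑ i, ∑ l, pd j (fun y => gi g y i l) x * pd k (fun y => g y i l) x =
    ∑ i, ∑ l, pd k (fun y => gi g y i l) x * pd j (fun y => g y i l) x := by
  set A : Fin n → Matrix (Fin n) (Fin n) ℝ := fun j => Matrix.of fun a b => pd j (fun y => gi g y a b) x with hA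
  set B : Fin n → Matrix (Fin n) (Fin n) ℝ := fun j => Matrix.of fun a b => pd j (fun y => g y a b) x with hB
  set G := Matrix.of (g x) with hG
  have hunit : IsUnit G.det := (hgpos x hx).det_pos.ne'.isUnit
  have hAB : ∀ j, A j * G + G⁻¹ * B j = 0 := by
    intro j
    ext a b
    have h1 : pd j (fun y => ∑ m, gi g y a m * g y m b) x = 0 := by
      rw [pd_congr hU (fun y hy => gi_g hgpos hy a b) hx, pd_const]
    have dg := fun i j => (g_sm hg i j).diff hU hx
    have dgi := fun i j => (gi_sm hg hgpos i j).diff hU hx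
    rw [pd_sum (by fun_prop)] at h1
    simp only [Matrix.add_apply, Matrix.mul_apply, Matrix.zero_apply]
    rw [← h1, ← Finset.sum_add_distrib]
    refine Finset.sum_congr rfl fun m _ => ?_
    rw [pd_mul (by fun_prop) (by fun_prop)]
    rfl
  have hA' : ∀ j, A j = -(G⁻¹ * B j * G⁻¹) := by
    intro j
    have h := congrArg (· * G⁻¹) (hAB j)
    simp only [add_mul, zero_mul] at h
    rw [Matrix.mul_assoc, Matrix.mul_nonsing_inv G hunit, Matrix.mul_one] at h
    exact eq_neg_of_add_eq_zero_left h
  have hT : ∀ j k, ∑ i, ∑ l, pd j (fun y => gi g y i l) x * pd k (fun y => g y i l) x =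
      (A j * B k).trace := by
    intro j k
    simp only [Matrix.trace, Matrix.diag, Matrix.mul_apply]
    refine Finset.sum_congr rfl fun a _ => Finset.sum_congr rfl fun b _ => ?_
    rw [dg_symm hU hgpos hx]
    rfl
  rw [hT, hT, hA', hA', neg_mul, neg_mul, Matrix.trace_neg, Matrix.trace_neg, Matrix.mul_assoc,
    Matrix.trace_mul_comm, ← Matrix.mul_assoc]

theorem dtau_symm (hU : IsOpen U) (hg : SmoothVF U g) (hgpos : ∀ x ∈ U, (Matrix.of (g x)).PosDef)
    {x : Fin n → ℝ} (hx : x ∈ U) (j k : Fin n) :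
    ∑ i, pd j (fun y => christoffel g y i i k) x = ∑ i, pd k (fun y => christoffel g y i i j) x := by
  have dg := fun i j a => ((g_sm hg i j).pd hU a).diff hU hx
  have dgi := fun i j => (gi_sm hg hgpos i j).diff hU hx
  have h : ∀ j k, ∑ i, pd j (fun y => christoffel g y i i k) x =
      (1 / 2) * (∑ i, ∑ l, pd j (fun y => gi g y i l) x * pd k (fun y => g y i l) x) +
      (1 / 2) * ∑ i, ∑ l, gi g x i l * pd j (pd k (fun y => g y i l)) x := by
    intro j k
    rw [← pd_sum (fun i => (chr_sm hU hg hgpos i i k).diff hU hx),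
      pd_congr hU (fun y hy => tau_eq hU hgpos hy k) hx, pd_sum (by fun_prop)]
    simp only [Finset.mul_sum, ← Finset.sum_add_distrib]
    refine Finset.sum_congr rfl fun a _ => ?_
    rw [pd_sum (by fun_prop)]
    refine Finset.sum_congr rfl fun b _ => ?_
    rw [pd_mul (by fun_prop) (by fun_prop), pd_mul (by fun_prop) (by fun_prop), pd_const]
    ring
  rw [h, h, dgi_dg hU hg hgpos hx]
  congr 2
  refine Finset.sum_congr rfl fun a _ => Finset.sum_congr rfl fun b _ => ?_
  rw [pd_comm hU (g_sm hg a b) hx]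

theorem ricC_symm (hU : IsOpen U) (hg : SmoothVF U g) (hgpos : ∀ x ∈ U, (Matrix.of (g x)).PosDef)
    {x : Fin n → ℝ} (hx : x ∈ U) (j k : Fin n) :
    ricC (christoffel g) x j k = ricC (christoffel g) x k j := by
  unfold ricC
  simp only [Finset.sum_add_distrib, Finset.sum_sub_distrib]
  rw [dtau_symm hU hg hgpos hx]
  congr 1
  · congr 1
    refine Finset.sum_congr rfl fun i _ => ?_
    exact pd_congr hU (fun y hy => chr_symm hU hgpos hy i j k) hx i
  · congr 1
    · refine Finset.sum_congr rfl fun i _ => Finset.sum_congr rfl fun m _ => ?_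
      rw [chr_symm hU hgpos hx m j k]
    · rw [Finset.sum_comm]
      refine Finset.sum_congr rfl fun i _ => Finset.sum_congr rfl fun m _ => ?_
      rw [chr_symm hU hgpos hx m j i, chr_symm hU hgpos hx i m k]
      ring

end metric

section final
variable {n : ℕ} {U : Set (Fin n → ℝ)} {g : (Fin n → ℝ) → Fin n → Fin n → ℝ} {P : VF n}

theorem alg1 (G : Fin n → Fin n → Fin n → ℝ) (g : Fin n → Fin n → ℝ) (p P : Fin n → ℝ)
    (hp : ∀ j, p j = ∑ m, g j m * P m) (gs : ∀ i j, g i j = g j i) (hu : ∑ m, p m * P m = 1)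
    (j k : Fin n) :
    ∑ i, ∑ m, (G i i m + (if i = i then 1 else 0) * p m - g i m * P i) *
      (G m j k + (if m = j then 1 else 0) * p k - g j k * P m) =
    ∑ i, ∑ m, G i i m * G m j k + (∑ i, G i i j) * p k - g j k * (∑ i, ∑ m, G i i m * P m)
     + ((n : ℝ) - 1) * (∑ m, p m * G m j k + p j * p k - g j k) := by
  have h1 : ∀ m, ∑ i, (G i i m + (if i = i then 1 else 0) * p m - g i m * P i) =
      ∑ i, G i i m + ((n : ℝ) - 1) * p m := by
    intro m
    simp only [Finset.sum_add_distrib, Finset.sum_sub_distrib]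
    have : ∑ i, g i m * P i = p m := by
      rw [hp]; exact Finset.sum_congr rfl fun i _ => by rw [gs]
    rw [this]
    simp
    ring
  rw [Finset.sum_comm]
  rw [Finset.sum_congr rfl (fun m _ => by rw [← Finset.sum_mul, h1 m])]
  have h2 : ∀ t : Fin n → ℝ, ∑ m, t m * (G m j k + (if m = j then 1 else 0) * p k - g j k * P m) =
      ∑ m, t m * G m j k + t j * p k - g j k * ∑ m, t m * P m := by
    intro t
    simp only [mul_add, mul_sub, Finset.sum_add_distrib, Finset.sum_sub_distrib, ite_mul, one_mul,
      zero_mul, mul_ite, mul_zero, Finset.sum_ite_eq', Finset.mem_univ, if_true, Finset.mul_sum]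
    congr 1
    exact Finset.sum_congr rfl fun i _ => by ring
  rw [h2]
  simp only [add_mul, Finset.sum_add_distrib, mul_assoc, ← Finset.mul_sum]
  rw [hu]
  have h3 : ∀ q : Fin n → ℝ, ∑ m, (∑ i, G i i m) * q m = ∑ i, ∑ m, G i i m * q m := by
    intro q
    rw [Finset.sum_comm]
    simp only [Finset.sum_mul]
  rw [h3, h3]
  ring

theorem alg2 (G : Fin n → Fin n → Fin n → ℝ) (g : Fin n → Fin n → ℝ) (p P : Fin n → ℝ)
    (hp : ∀ j, p j = ∑ m, g j m * P m) (gs : ∀ i j, g i j = g j i) (hu : ∑ m, p m * P m = 1)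
    (j k : Fin n) :
    ∑ i, ∑ m, (G i j m + (if i = j then 1 else 0) * p m - g j m * P i) *
      (G m i k + (if m = i then 1 else 0) * p k - g i k * P m) =
    ∑ i, ∑ m, G i j m * G m i k + (∑ i, G i j i) * p k - ∑ i, ∑ m, G i j m * g i k * P m
     + ∑ m, p m * G m j k - ∑ i, ∑ m, g j m * P i * G m i k + p j * p k - g j k := by
  have h1 : ∀ i, ∑ m, (G i j m + (if i = j then 1 else 0) * p m - g j m * P i) *
      (G m i k + (if m = i then 1 else 0) * p k - g i k * P m) =
      (∑ m, G i j m * G m i k + G i j i * p k - ∑ m, G i j m * g i k * P m)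
      + (if i = j then (∑ m, p m * G m i k + p i * p k - g i k) else 0)
      - (∑ m, g j m * P i * G m i k + g j i * P i * p k - (g i k * P i) * p j) := by
    intro i
    have e1 : ∑ m, (if i = j then 1 else 0) * p m *
      (G m i k + (if m = i then 1 else 0) * p k - g i k * P m) =
      (if i = j then (∑ m, p m * G m i k + p i * p k - g i k) else 0) := by
      split_ifs with h
      · simp only [one_mul, mul_add, mul_sub, Finset.sum_add_distrib, Finset.sum_sub_distrib,
          ite_mul, zero_mul, mul_ite, mul_zero, Finset.sum_ite_eq', Finset.mem_univ, if_true]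
        congr 1
        have : ∑ m, p m * (g i k * P m) = g i k * ∑ m, p m * P m := by
          rw [Finset.mul_sum]; exact Finset.sum_congr rfl fun i _ => by ring
        rw [this, hu, mul_one]
      · simp
    rw [← e1, hp j, Finset.mul_sum]
    simp only [mul_add, mul_sub, add_mul, sub_mul, Finset.sum_add_distrib, Finset.sum_sub_distrib,
      ite_mul, one_mul, zero_mul, mul_ite, mul_zero, Finset.sum_ite_eq', Finset.mem_univ, if_true]
    have e2 : ∑ m, G i j m * (g i k * P m) = ∑ m, G i j m * g i k * P m :=
      Finset.sum_congr rfl fun i _ => by ring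
    have e3 : ∑ m, g j m * P i * (g i k * P m) = ∑ m, g i k * P i * (g j m * P m) :=
      Finset.sum_congr rfl fun i _ => by ring
    rw [e2, e3]
    ring
  simp only [h1, Finset.sum_add_distrib, Finset.sum_sub_distrib, Finset.sum_ite_eq',
    Finset.mem_univ, if_true, ← Finset.sum_mul]
  have e4 : ∑ i, g i k * P i = p k := by
    rw [hp]; exact Finset.sum_congr rfl fun i _ => by rw [gs]
  rw [e4, ← hp]
  ring

/-- components of `∇P` -/
noncomputable def nP (g : (Fin n → ℝ) → Fin n → Fin n → ℝ) (P : VF n) (x : Fin n → ℝ)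
    (a m : Fin n) : ℝ :=
  pd a (fun y => P y m) x + ∑ l, christoffel g x m a l * P x l

noncomputable def hP (g : (Fin n → ℝ) → Fin n → Fin n → ℝ) (P : VF n) (x : Fin n → ℝ)
    (a b : Fin n) : ℝ := ∑ m, g x b m * nP g P x a m

theorem hP_skew (hgpos : ∀ x ∈ U, (Matrix.of (g x)).PosDef)
    (hKilling : ∀ X Y : VF n, SmoothVF U X → SmoothVF U Y → ∀ x ∈ U,
      gval g x (lcCov g X P x) (Y x) + gval g x (lcCov g Y P x) (X x) = 0)
    {x : Fin n → ℝ} (hx : x ∈ U) (a b : Fin n) : hP g P x a b = - hP g P x b a := by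
  have h := hKilling (fun _ => Pi.single a 1) (fun _ => Pi.single b 1)
    contDiffOn_const contDiffOn_const x hx
  have e : ∀ a b : Fin n, gval g x (lcCov g (fun _ => Pi.single a 1) P x) (Pi.single b 1) =
      hP g P x a b := by
    intro a b
    unfold gval hP nP
    refine Finset.sum_congr rfl fun m _ => ?_
    simp [lcCov, fderiv_eq_sum, Pi.single_apply]
    rw [g_symm hgpos hx]
    simp
  simp only [e] at h
  linarith

theorem dpf0 (hU : IsOpen U) (hg : SmoothVF U g) (hPs : SmoothVF U P)
    {x : Fin n → ℝ} (hx : x ∈ U) (a b : Fin n) : pd a (fun y => pf g P y b) x =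
      ∑ m, pd a (fun y => g y b m) x * P x m + ∑ m, g x b m * pd a (fun y => P y m) x := by
  have d1 := fun i j => (g_sm hg i j).diff hU hx
  have d2 := fun i => (smVF_iff.1 hPs i).diff hU hx
  unfold pf
  rw [pd_sum (by fun_prop), ← Finset.sum_add_distrib]
  refine Finset.sum_congr rfl fun m _ => ?_
  rw [pd_mul (by fun_prop) (by fun_prop)]

theorem dpf (hU : IsOpen U) (hg : SmoothVF U g) (hgpos : ∀ x ∈ U, (Matrix.of (g x)).PosDef)
    (hPs : SmoothVF U P) {x : Fin n → ℝ} (hx : x ∈ U) (a b : Fin n) :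
    pd a (fun y => pf g P y b) x = hP g P x a b + ∑ m, pf g P x m * christoffel g x m a b := by
  rw [dpf0 hU hg hPs hx]
  unfold hP nP pf
  simp only [compat hU hgpos hx, add_mul, mul_add, Finset.sum_add_distrib, Finset.sum_mul, Finset.mul_sum]
  have e1 : ∑ m, ∑ l, g x m l * christoffel g x l a b * P x m =
      ∑ m, ∑ l, g x m l * P x l * christoffel g x m a b := by
    rw [Finset.sum_comm]
    refine Finset.sum_congr rfl fun m _ => Finset.sum_congr rfl fun l _ => ?_
    rw [g_symm hgpos hx]; ring
  have e2 : ∑ m, ∑ l, g x b l * christoffel g x l a m * P x m =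
      ∑ m, ∑ l, g x b m * (christoffel g x m a l * P x l) := by
    rw [Finset.sum_comm]
    refine Finset.sum_congr rfl fun m _ => Finset.sum_congr rfl fun l _ => ?_
    ring
  rw [e1, e2]; ring

theorem unit_pf (hPunit : ∀ x ∈ U, gval g x (P x) (P x) = 1) {x : Fin n → ℝ} (hx : x ∈ U) :
    ∑ m, pf g P x m * P x m = 1 := by
  rw [← hPunit x hx]
  unfold gval pf
  simp only [Finset.sum_mul]
  refine Finset.sum_congr rfl fun m _ => Finset.sum_congr rfl fun l _ => ?_
  ring

theorem hP_P (hU : IsOpen U) (hg : SmoothVF U g) (hgpos : ∀ x ∈ U, (Matrix.of (g x)).PosDef)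
    (hPs : SmoothVF U P) (hPunit : ∀ x ∈ U, gval g x (P x) (P x) = 1)
    {x : Fin n → ℝ} (hx : x ∈ U) (a : Fin n) : ∑ b, hP g P x a b * P x b = 0 := by
  have d1 := fun i => (pf_sm hg hPs i).diff hU hx
  have d2 := fun i => (smVF_iff.1 hPs i).diff hU hx
  have h : pd a (fun y => ∑ m, pf g P y m * P y m) x = 0 := by
    rw [pd_congr hU (fun y hy => unit_pf hPunit hy) hx, pd_const]
  rw [pd_sum (by fun_prop)] at h
  have h' : ∑ m, ((hP g P x a m + ∑ l, pf g P x l * christoffel g x l a m) * P x m +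
      pf g P x m * pd a (fun y => P y m) x) = 0 := by
    rw [← h]
    refine Finset.sum_congr rfl fun m _ => ?_
    rw [pd_mul (by fun_prop) (by fun_prop), dpf hU hg hgpos hPs hx]
  have e : ∑ b, hP g P x a b * P x b = ∑ m, pf g P x m * pd a (fun y => P y m) x
      + ∑ m, (∑ l, pf g P x l * christoffel g x l a m) * P x m := by
    have e0 : ∑ b, hP g P x a b * P x b = ∑ m, pf g P x m * nP g P x a m := by
      unfold hP pf
      simp only [Finset.sum_mul]
      rw [Finset.sum_comm]
      refine Finset.sum_congr rfl fun m _ => Finset.sum_congr rfl fun l _ => ?_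
      rw [g_symm hgpos hx]; ring
    rw [e0]
    unfold nP
    simp only [mul_add, Finset.sum_add_distrib, Finset.mul_sum, Finset.sum_mul]
    congr 1
    rw [Finset.sum_comm]
    refine Finset.sum_congr rfl fun m _ => Finset.sum_congr rfl fun l _ => ?_
    ring
  simp only [add_mul, Finset.sum_add_distrib] at h'
  linarith

theorem div_zero' (hgpos : ∀ x ∈ U, (Matrix.of (g x)).PosDef)
    (hKilling : ∀ X Y : VF n, SmoothVF U X → SmoothVF U Y → ∀ x ∈ U,
      gval g x (lcCov g X P x) (Y x) + gval g x (lcCov g Y P x) (X x) = 0)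
    {x : Fin n → ℝ} (hx : x ∈ U) : ∑ i, nP g P x i i = 0 := by
  have h1 : ∀ i, nP g P x i i = ∑ b, gi g x i b * hP g P x i b := by
    intro i
    unfold hP
    simp only [Finset.mul_sum, ← mul_assoc]
    rw [Finset.sum_comm]
    simp only [← Finset.sum_mul, gi_g hgpos hx]
    simp
  have h2 : ∑ i, nP g P x i i = - ∑ i, nP g P x i i := by
    simp only [h1]
    rw [← Finset.sum_neg_distrib]
    conv_lhs => rw [Finset.sum_comm]
    refine Finset.sum_congr rfl fun m _ => ?_
    rw [← Finset.sum_neg_distrib]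
    refine Finset.sum_congr rfl fun l _ => ?_
    rw [gi_symm hgpos hx, hP_skew hgpos hKilling hx]; ring
  linarith

theorem ricC_cbar (hU : IsOpen U) (hg : SmoothVF U g) (hgpos : ∀ x ∈ U, (Matrix.of (g x)).PosDef)
    (hPs : SmoothVF U P) (hPunit : ∀ x ∈ U, gval g x (P x) (P x) = 1)
    (hKilling : ∀ X Y : VF n, SmoothVF U X → SmoothVF U Y → ∀ x ∈ U,
      gval g x (lcCov g X P x) (Y x) + gval g x (lcCov g Y P x) (X x) = 0)
    {x : Fin n → ℝ} (hx : x ∈ U) (j k : Fin n) :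
    ricC (cbar g P) x j k = ricC (christoffel g) x j k
      - ((n : ℝ) - 2) * (hP g P x j k - pf g P x j * pf g P x k + g x j k) := by
  have d0 := fun i j => (g_sm hg i j).diff hU hx
  have d1 := fun i => (pf_sm hg hPs i).diff hU hx
  have d2 := fun i => (smVF_iff.1 hPs i).diff hU hx
  have d3 := fun i j k => (chr_sm hU hg hgpos i j k).diff hU hx
  have hd : ∀ a i j k, pd a (fun y => cbar g P y i j k) x = pd a (fun y => christoffel g y i j k) x
      + (if i = j then 1 else 0) * pd a (fun y => pf g P y k) x
      - (pd a (fun y => g y j k) x * P x i + g x j k * pd a (fun y => P y i) x) := by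
    intro a i j k
    unfold cbar
    rw [pd_sub (by fun_prop) (by fun_prop), pd_add (by fun_prop) (by fun_prop),
      pd_mul (by fun_prop) (by fun_prop), pd_mul (by fun_prop) (by fun_prop), pd_const]
    ring
  have hp : ∀ j, pf g P x j = ∑ m, g x j m * P x m := fun j => rfl
  have a1 := alg1 (christoffel g x) (g x) (pf g P x) (P x) hp (g_symm hgpos hx)
    (unit_pf hPunit hx) j k
  have a2 := alg2 (christoffel g x) (g x) (pf g P x) (P x) hp (g_symm hgpos hx)
    (unit_pf hPunit hx) j k
  have a1' : ∑ i, ∑ m, cbar g P x i i m * cbar g P x m j k = _ := a1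
  have a2' : ∑ i, ∑ m, cbar g P x i j m * cbar g P x m i k = _ := a2
  unfold ricC
  simp only [hd, if_true, one_mul]
  simp only [Finset.sum_add_distrib, Finset.sum_sub_distrib]
  rw [a1', a2']
  have b1 : ∑ i, (if i = j then (1:ℝ) else 0) * pd i (fun y => pf g P y k) x =
    pd j (fun y => pf g P y k) x := by simp
  have b2 : ∑ _i : Fin n, pd j (fun y => pf g P y k) x =
    n * pd j (fun y => pf g P y k) x := by simp
  have b3 : ∑ i, pd j (fun y => g y i k) x * P x i + ∑ i, g x i k * pd j (fun y => P y i) x =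
      pd j (fun y => pf g P y k) x := by
    rw [dpf0 hU hg hPs hx]
    congr 1
    · exact Finset.sum_congr rfl fun m _ => by rw [dg_symm hU hgpos hx]
    · exact Finset.sum_congr rfl fun m _ => by rw [g_symm hgpos hx]
  have b4 := dpf hU hg hgpos hPs hx j k
  have b5 : ∑ i, g x j k * pd i (fun y => P y i) x =
      - (g x j k * ∑ i, ∑ m, christoffel g x i i m * P x m) := by
    have := div_zero' hgpos hKilling hx
    unfold nP at this
    rw [Finset.sum_add_distrib] at this
    rw [← Finset.mul_sum, eq_neg_of_add_eq_zero_left this]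
    ring
  have b6 : ∑ i, pd i (fun y => g y j k) x * P x i =
      ∑ i, ∑ m, christoffel g x i j m * g x i k * P x m +
      ∑ i, ∑ m, g x j m * P x i * christoffel g x m i k := by
    simp only [compat hU hgpos hx, add_mul, Finset.sum_add_distrib, Finset.sum_mul]
    congr 1
    · rw [Finset.sum_comm]
      refine Finset.sum_congr rfl fun m _ => Finset.sum_congr rfl fun l _ => ?_
      rw [g_symm hgpos hx, chr_symm hU hgpos hx]; ring
    · refine Finset.sum_congr rfl fun m _ => Finset.sum_congr rfl fun l _ => ?_
      ring
  have b7 : ∑ i, christoffel g x i j i = ∑ i, christoffel g x i i j :=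
    Finset.sum_congr rfl fun m _ => by rw [chr_symm hU hgpos hx]
  rw [b1, b2, b3, b4, b5, b6, b7]
  ring

theorem covC_cbar (hU : IsOpen U) (hg : SmoothVF U g) (hgpos : ∀ x ∈ U, (Matrix.of (g x)).PosDef)
    (hPs : SmoothVF U P) (hPunit : ∀ x ∈ U, gval g x (P x) (P x) = 1)
    (hKilling : ∀ X Y : VF n, SmoothVF U X → SmoothVF U Y → ∀ x ∈ U,
      gval g x (lcCov g X P x) (Y x) + gval g x (lcCov g Y P x) (X x) = 0)
    {x : Fin n → ℝ} (hx : x ∈ U) (i j k : Fin n) :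
    covC (cbar g P) (fun y a b => (ricC (cbar g P) y a b + ricC (cbar g P) y b a) / 2) x i j k =
      covC (christoffel g) (ricC (christoffel g)) x i j k
      + g x i k * (∑ m, ricC (cbar g P) x j m * P x m) - pf g P x j * ricC (cbar g P) x i k
      + g x i j * (∑ m, ricC (cbar g P) x k m * P x m) - pf g P x k * ricC (cbar g P) x i j := by
  set c : ℝ := (n : ℝ) - 2 with hc
  have d0 := fun i j => (g_sm hg i j).diff hU hx
  have d1 := fun i => (pf_sm hg hPs i).diff hU hx
  have d3 := fun j k => (ricC_smooth hU (chr_sm hU hg hgpos) j k).diff hU hx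
  have hr : ∀ y ∈ U, ∀ a b, ricC (cbar g P) y a b = ricC (christoffel g) y a b
      - c * (hP g P y a b - pf g P y a * pf g P y b + g y a b) :=
    fun y hy a b => ricC_cbar hU hg hgpos hPs hPunit hKilling hy a b
  have ht : ∀ y ∈ U, ∀ a b, (ricC (cbar g P) y a b + ricC (cbar g P) y b a) / 2 =
      ricC (christoffel g) y a b + c * (pf g P y a * pf g P y b - g y a b) := by
    intro y hy a b
    rw [hr y hy, hr y hy, hP_skew hgpos hKilling hy b a, ricC_symm hU hg hgpos hy b a,
      g_symm hgpos hy b a]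
    ring
  have hdt : pd i (fun y => (ricC (cbar g P) y j k + ricC (cbar g P) y k j) / 2) x =
      pd i (fun y => ricC (christoffel g) y j k) x +
      c * (pd i (fun y => pf g P y j) x * pf g P x k + pf g P x j * pd i (fun y => pf g P y k) x
        - pd i (fun y => g y j k) x) := by
    rw [pd_congr hU (fun y hy => ht y hy j k) hx, pd_add (by fun_prop) (by fun_prop),
      pd_mul (by fun_prop) (by fun_prop), pd_const, pd_sub (by fun_prop) (by fun_prop),
      pd_mul (by fun_prop) (by fun_prop)]
    ring
  have hu := unit_pf hPunit hx
  have hgP : ∀ a, ∑ m, g x a m * P x m = pf g P x a := fun a => rfl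
  have hrP : ∀ a, ∑ m, ricC (cbar g P) x a m * P x m = ∑ m, ricC (christoffel g) x a m * P x m := by
    intro a
    have e : ∀ m, ricC (cbar g P) x a m * P x m = ricC (christoffel g) x a m * P x m
      - c * (hP g P x a m * P x m - pf g P x a * (pf g P x m * P x m) + g x a m * P x m) := by
      intro m; rw [hr x hx]; ring
    simp only [e, Finset.sum_sub_distrib, ← Finset.mul_sum, Finset.sum_add_distrib]
    rw [hP_P hU hg hgpos hPs hPunit hx, hu, hgP]
    ring
  have htP : ∀ a, ∑ m, P x m *
      (ricC (christoffel g) x m a + c * (pf g P x m * pf g P x a - g x m a)) =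
      ∑ m, ricC (christoffel g) x a m * P x m := by
    intro a
    have e : ∀ m, P x m * (ricC (christoffel g) x m a + c * (pf g P x m * pf g P x a - g x m a)) =
      ricC (christoffel g) x a m * P x m
      + c * ((pf g P x m * P x m) * pf g P x a - g x a m * P x m) := by
      intro m; rw [ricC_symm hU hg hgpos hx m a, g_symm hgpos hx m a]; ring
    simp only [e, Finset.sum_sub_distrib, ← Finset.mul_sum, Finset.sum_add_distrib, ← Finset.sum_mul]
    rw [hu, hgP]
    ring
  have hts : ∀ a b, ricC (christoffel g) x a b + c * (pf g P x a * pf g P x b - g x a b) =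
      ricC (christoffel g) x b a + c * (pf g P x b * pf g P x a - g x b a) := by
    intro a b
    rw [ricC_symm hU hg hgpos hx a b, g_symm hgpos hx a b]; ring
  have hS : ∀ a b : Fin n, ∑ m, cbar g P x m i a *
      (ricC (christoffel g) x m b + c * (pf g P x m * pf g P x b - g x m b)) =
      ∑ m, christoffel g x m i a * ricC (christoffel g) x m b
      + c * ((∑ m, pf g P x m * christoffel g x m i a) * pf g P x b
        - ∑ m, g x b m * christoffel g x m i a)
      + pf g P x a * (ricC (christoffel g) x i b + c * (pf g P x i * pf g P x b - g x i b))
      - g x i a * ∑ m, ricC (christoffel g) x b m * P x m := by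
    intro a b
    rw [← htP b]
    unfold cbar
    simp only [add_mul, sub_mul, Finset.sum_add_distrib, Finset.sum_sub_distrib, ite_mul, one_mul,
      zero_mul, Finset.sum_ite_eq', Finset.mem_univ, if_true, mul_assoc, ← Finset.mul_sum]
    congr 1
    congr 1
    simp only [mul_add, mul_sub, Finset.sum_add_distrib, Finset.sum_sub_distrib, Finset.mul_sum,
      Finset.sum_mul]
    congr 1
    congr 1
    · exact Finset.sum_congr rfl fun m _ => by ring
    · exact Finset.sum_congr rfl fun m _ => by rw [g_symm hgpos hx]; ring
  unfold covC
  rw [hdt]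
  simp only [ht x hx]
  simp only [fun m => hts j m]
  rw [hS, hS, hrP, hrP, hr x hx, hr x hx, dpf hU hg hgpos hPs hx, dpf hU hg hgpos hPs hx,
    compat hU hgpos hx]
  simp only [fun m => ricC_symm hU hg hgpos hx j m]
  ring

theorem tri1 (a b : Fin n → Fin n → ℝ) (P X Y Z : Fin n → ℝ) :
    (∑ i, ∑ k, a i k * X i * Z k) * (∑ j, ∑ m, b j m * Y j * P m) =
    ∑ i, ∑ j, ∑ k, a i k * (∑ m, b j m * P m) * X i * Y j * Z k := by
  have e : ∀ j, ∑ m, b j m * Y j * P m = (∑ m, b j m * P m) * Y j := by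
    intro j; rw [Finset.sum_mul]; exact Finset.sum_congr rfl fun m _ => by ring
  simp only [e]
  generalize (fun j => ∑ m, b j m * P m) = q
  rw [Finset.sum_mul]
  refine Finset.sum_congr rfl fun i _ => ?_
  rw [Finset.sum_mul_sum, Finset.sum_comm]
  refine Finset.sum_congr rfl fun j _ => Finset.sum_congr rfl fun k _ => ?_
  ring

theorem tri2 (p : Fin n → ℝ) (b : Fin n → Fin n → ℝ) (X Y Z : Fin n → ℝ) :
    (∑ j, p j * Y j) * (∑ i, ∑ k, b i k * X i * Z k) =
    ∑ i, ∑ j, ∑ k, p j * b i k * X i * Y j * Z k := by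
  rw [mul_comm, Finset.sum_mul]
  refine Finset.sum_congr rfl fun i _ => ?_
  rw [Finset.sum_mul_sum, Finset.sum_comm]
  refine Finset.sum_congr rfl fun j _ => Finset.sum_congr rfl fun k _ => ?_
  ring

theorem tri_swap (f : Fin n → Fin n → Fin n → ℝ) :
    ∑ i, ∑ j, ∑ k, f i j k = ∑ i, ∑ j, ∑ k, f i k j :=
  Finset.sum_congr rfl fun _ _ => Finset.sum_comm

theorem main_diff (hU : IsOpen U) (hg : SmoothVF U g) (hgpos : ∀ x ∈ U, (Matrix.of (g x)).PosDef)
    (hPs : SmoothVF U P) (hPunit : ∀ x ∈ U, gval g x (P x) (P x) = 1)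
    (hKilling : ∀ X Y : VF n, SmoothVF U X → SmoothVF U Y → ∀ x ∈ U,
      gval g x (lcCov g X P x) (Y x) + gval g x (lcCov g Y P x) (X x) = 0)
    (X Y Z : VF n) (hX : SmoothVF U X) (hY : SmoothVF U Y) (hZ : SmoothVF U Z)
    {x : Fin n → ℝ} (hx : x ∈ U) :
    covT (ssCov g P) (shat g P) X Y Z x = covT (lcCov g) (ricci (lcCov g)) X Y Z x +
      (gval g x (X x) (Z x) * ricci (ssCov g P) Y P x
            - gval g x (Y x) (P x) * ricci (ssCov g P) X Z x
            + gval g x (X x) (Y x) * ricci (ssCov g P) Z P x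
            - gval g x (Z x) (P x) * ricci (ssCov g P) X Y x) := by
  have hC := cbar_sm hU hg hgpos hPs
  have hL := chr_sm hU hg hgpos
  rw [lcCov_eq, covT_conn hU hL (ricC_smooth hU hL)
    (fun Y Z hY hZ x hx => ricci_conn hU hL hY hZ hx) hX hY hZ hx]
  have hT : ∀ Y Z, SmoothVF U Y → SmoothVF U Z → ∀ x ∈ U, shat g P Y Z x =
      ∑ j, ∑ k, ((ricC (cbar g P) x j k + ricC (cbar g P) x k j) / 2) * Y x j * Z x k := by
    intro Y Z hY hZ x hx
    unfold shat
    rw [ssCov_eq, ricci_conn hU hC hY hZ hx, ricci_conn hU hC hZ hY hx]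
    rw [Finset.sum_comm (f := fun j k => ricC (cbar g P) x j k * Z x j * Y x k),
      ← Finset.sum_add_distrib, Finset.sum_div]
    refine Finset.sum_congr rfl fun j _ => ?_
    rw [← Finset.sum_add_distrib, Finset.sum_div]
    refine Finset.sum_congr rfl fun k _ => ?_
    ring
  have hsm : ∀ a b, Sm U (fun y => (ricC (cbar g P) y a b + ricC (cbar g P) y b a) / 2) := by
    intro a b
    simp only [div_eq_mul_inv]
    exact ((ricC_smooth hU hC a b).add (ricC_smooth hU hC b a)).mul (Sm.const _)
  rw [ssCov_eq, covT_conn hU hC hsm hT hX hY hZ hx, ricci_conn hU hC hY hPs hx,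
    ricci_conn hU hC hX hZ hx, ricci_conn hU hC hZ hPs hx, ricci_conn hU hC hX hY hx]
  have hpi : ∀ v : Fin n → ℝ, gval g x v (P x) = ∑ j, pf g P x j * v j := by
    intro v
    unfold gval pf
    simp only [Finset.sum_mul]
    exact Finset.sum_congr rfl fun m _ => Finset.sum_congr rfl fun l _ => by ring
  rw [hpi, hpi]
  unfold gval
  rw [tri1, tri1, tri2, tri2, tri_swap (fun i j k => g x i k * (∑ m, _) * X x i * Z x j * Y x k),
    tri_swap (fun i j k => pf g P x j * _ * X x i * Z x j * Y x k)]
  simp only [← Finset.sum_add_distrib, ← Finset.sum_sub_distrib]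
  refine Finset.sum_congr rfl fun i _ => Finset.sum_congr rfl fun j _ =>
    Finset.sum_congr rfl fun k _ => ?_
  rw [covC_cbar hU hg hgpos hPs hPunit hKilling hx]
  ring

end final

/-- On an open `U ⊆ ℝⁿ` (`n ≥ 3`) with Riemannian metric `g`, Levi-Civita
connection `∇`, vector field `P`, semi-symmetric metric connection `∇̄`, `S = Ric_∇`,
`S̄ = Ric_∇̄`, `Ŝ = sym S̄`: suppose `P` is a unit Killing vector field (`g(P,P) = 1` and
`g(∇_X P, Y) + g(∇_Y P, X) = 0` for all vector fields `X, Y`).  Then `∇S ≡ 0` if and only if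
for all vector fields `X, Y, Z`:
`(∇̄_X Ŝ)(Y,Z) = g(X,Z)S̄(Y,P) − g(Y,P)S̄(X,Z) + g(X,Y)S̄(Z,P) − g(Z,P)S̄(X,Y)`. -/
theorem statement6 (n : ℕ) (hn : 3 ≤ n)
    (U : Set (Fin n → ℝ)) (hU : IsOpen U)
    (g : (Fin n → ℝ) → Fin n → Fin n → ℝ) (hg : SmoothVF U g)
    (hgpos : ∀ x ∈ U, (Matrix.of (g x)).PosDef)
    (P : VF n) (hP : SmoothVF U P)
    (hPunit : ∀ x ∈ U, gval g x (P x) (P x) = 1)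
    (hKilling : ∀ X Y : VF n, SmoothVF U X → SmoothVF U Y → ∀ x ∈ U,
      gval g x (lcCov g X P x) (Y x) + gval g x (lcCov g Y P x) (X x) = 0) :
    (∀ X Y Z : VF n, SmoothVF U X → SmoothVF U Y → SmoothVF U Z → ∀ x ∈ U,
        covT (lcCov g) (ricci (lcCov g)) X Y Z x = 0) ↔
      (∀ X Y Z : VF n, SmoothVF U X → SmoothVF U Y → SmoothVF U Z → ∀ x ∈ U,
        covT (ssCov g P) (shat g P) X Y Z x =
          gval g x (X x) (Z x) * ricci (ssCov g P) Y P x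
            - gval g x (Y x) (P x) * ricci (ssCov g P) X Z x
            + gval g x (X x) (Y x) * ricci (ssCov g P) Z P x
            - gval g x (Z x) (P x) * ricci (ssCov g P) X Y x) := by
  constructor
  · intro h X Y Z hX hY hZ x hx
    rw [main_diff hU hg hgpos hP hPunit hKilling X Y Z hX hY hZ hx, h X Y Z hX hY hZ x hx, zero_add]
  · intro h X Y Z hX hY hZ x hx
    have h1 := main_diff hU hg hgpos hP hPunit hKilling X Y Z hX hY hZ hx
    rw [h X Y Z hX hY hZ x hx] at h1
    linarith
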